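/- Suppose the star-connected occupied component C(0) containing the origin is finite and nonempty. Then for every square S_k ∈ C(0) there exists a unique cycle D_k in G_C satisfying: (a) S_k is contained in the interior of D_k; (b) every edge of D_k is a boundary edge adjacent to an occupied square of C(0) lying in the interior of D_k and to a vacant square lying in the exterior of D_k; (c) for every cycle C in G_C that contains S_k in its interior, every edge of C either belongs to D_k or is contained in the interior of D_k. -/

import Mathlib

/-!
Common framework: tile ℝ² into closed unit squares indexed by `ℤ²`, with corners
forming a translate of `ℤ²` and the origin the centre of the square `S₀` (index `(0,0)`).
A cycle is identified with its edge set (a set of unordered pairs of corners);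
its interior (resp. exterior) is the union of the bounded (resp. unbounded)
connected components of the complement of the closed curve it traces in the plane.
-/

/-- Corners of the grid squares, indexed by `ℤ²`. -/
abbrev GridV := ℤ × ℤ

/-- Embedding of corners into the plane: the square of index `z` is
`[z₁ - 1/2, z₁ + 1/2] × [z₂ - 1/2, z₂ + 1/2]`, so the origin is the centre of `S₀`. -/
noncomputable def toPlane (v : GridV) : ℝ × ℝ := ((v.1 : ℝ) - 1 / 2, (v.2 : ℝ) - 1 / 2)

/-- The closed unit square of index `z`. -/
def squareSet (z : GridV) : Set (ℝ × ℝ) :=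
  Set.Icc ((z.1 : ℝ) - 1 / 2, (z.2 : ℝ) - 1 / 2) ((z.1 : ℝ) + 1 / 2, (z.2 : ℝ) + 1 / 2)

/-- The four edges (unit segments) of the square of index `z`, as unordered pairs of corners. -/
def squareEdges (z : GridV) : Set (Sym2 GridV) :=
  {s(z, z + (1, 0)), s(z + (1, 0), z + (1, 1)), s(z + (1, 1), z + (0, 1)), s(z + (0, 1), z)}

/-- Adjacency of corners in the full grid graph `G`: Euclidean distance one. -/
def GridAdj (u v : GridV) : Prop := |u.1 - v.1| + |u.2 - v.2| = 1

/-- A cycle in the full grid graph: a cyclic sequence `(v₀, …, v_{n-1}, v₀)` of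
distinct corners with consecutive corners adjacent. -/
structure GridCycle where
  n : ℕ
  hn : 3 ≤ n
  f : ZMod n → GridV
  inj : Function.Injective f
  adj : ∀ i, GridAdj (f i) (f (i + 1))

/-- The edge set of a grid cycle. -/
def GridCycle.edgeSet (C : GridCycle) : Set (Sym2 GridV) :=
  {e | ∃ i : ZMod C.n, e = s(C.f i, C.f (i + 1))}

/-- An edge set is (the edge set of) a cycle of the grid graph `G`.
We identify a cycle with its edge set. -/
def IsCycle (E : Set (Sym2 GridV)) : Prop := ∃ C : GridCycle, C.edgeSet = E

/-- A cycle of the subgraph of the grid graph with edge set `G`. -/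
def IsCycleIn (G E : Set (Sym2 GridV)) : Prop := IsCycle E ∧ E ⊆ G

/-- The vertices incident to some edge of `E`. -/
def vertexSetOf (E : Set (Sym2 GridV)) : Set GridV := {v | ∃ e ∈ E, v ∈ e}

/-- The closed segment in the plane realizing an edge. -/
noncomputable def edgeSeg : Sym2 GridV → Set (ℝ × ℝ) :=
  Sym2.lift ⟨fun a b => segment ℝ (toPlane a) (toPlane b), fun _ _ => segment_symm ℝ _ _⟩

/-- The closed curve in the plane traced by the edges of `E`. -/
noncomputable def carrierOf (E : Set (Sym2 GridV)) : Set (ℝ × ℝ) := ⋃ e ∈ E, edgeSeg e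

/-- The interior of a cycle: the union of the bounded connected components of the
complement of its carrier curve. -/
noncomputable def interiorOf (E : Set (Sym2 GridV)) : Set (ℝ × ℝ) :=
  {p | p ∉ carrierOf E ∧ Bornology.IsBounded (connectedComponentIn (carrierOf E)ᶜ p)}

/-- The exterior of a cycle: the union of the unbounded connected components of the
complement of its carrier curve. -/
noncomputable def exteriorOf (E : Set (Sym2 GridV)) : Set (ℝ × ℝ) :=
  {p | p ∉ carrierOf E ∧ ¬ Bornology.IsBounded (connectedComponentIn (carrierOf E)ᶜ p)}

/-- The set `A` is contained in the interior of the cycle `E` (points of the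
curve itself being allowed, so that e.g. a square whose boundary edges lie on the
cycle counts as contained in the interior). -/
def inInterior (E : Set (Sym2 GridV)) (A : Set (ℝ × ℝ)) : Prop :=
  A ⊆ interiorOf E ∪ carrierOf E

/-- The set `A` lies in the exterior of the cycle `E` (points of the curve itself
being allowed). -/
def inExterior (E : Set (Sym2 GridV)) (A : Set (ℝ × ℝ)) : Prop :=
  A ⊆ exteriorOf E ∪ carrierOf E

/-- Star adjacency: distinct squares sharing at least a corner. -/
def starAdj (z w : GridV) : Prop := z ≠ w ∧ |z.1 - w.1| ≤ 1 ∧ |z.2 - w.2| ≤ 1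

/-- Plus adjacency: squares sharing an edge. -/
def plusAdj (z w : GridV) : Prop := |z.1 - w.1| + |z.2 - w.2| = 1

/-- The star-connected occupied component `C(0)` of the square `S₀` (of index `(0,0)`),
for the occupancy configuration `ω`; empty if `S₀` is vacant. -/
def starComp (ω : GridV → Prop) : Set GridV :=
  {z | ω z ∧ Relation.ReflTransGen (fun a b => ω a ∧ ω b ∧ starAdj a b) (0, 0) z}

/-- The plus-connected occupied component `C⁺(0)` of the square `S₀`. -/
def plusComp (ω : GridV → Prop) : Set GridV :=
  {z | ω z ∧ Relation.ReflTransGen (fun a b => ω a ∧ ω b ∧ plusAdj a b) (0, 0) z}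

/-- The edge set of the graph `G_C`: all edges of squares of `C(0)`. -/
def gcEdges (ω : GridV → Prop) : Set (Sym2 GridV) := ⋃ z ∈ starComp ω, squareEdges z

/-- The edge set of the graph `G⁺_C`: all edges of squares of `C⁺(0)`. -/
def gpcEdges (ω : GridV → Prop) : Set (Sym2 GridV) := ⋃ z ∈ plusComp ω, squareEdges z

/-- `e` is an outermost boundary edge of the graph with edge set `G`: for every
cycle `E` in this graph, either `e` is an edge of `E` or `e` lies in the exterior of `E`. -/
def outermostBoundaryEdgeIn (G : Set (Sym2 GridV)) (e : Sym2 GridV) : Prop :=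
  e ∈ G ∧ ∀ E, IsCycleIn G E → e ∈ E ∨ inExterior E (edgeSeg e)

/-- The subgraph spanned by the edge set `E` is connected: any two incident vertices
are joined by a walk using only edges of `E`. -/
def EdgeSetConnected (E : Set (Sym2 GridV)) : Prop :=
  ∀ u v, u ∈ vertexSetOf E → v ∈ vertexSetOf E →
    ∃ p : List GridV, p.head? = some u ∧ p.getLast? = some v ∧
      List.Chain' (fun a b => s(a, b) ∈ E) p

/-- `D` is the outermost boundary cycle `D_k` of the square of index `z` of the star
component `C(0)`: (a) the square lies in the interior of `D`; (b) every edge of `D` is a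
boundary edge adjacent to an occupied square of `C(0)` in the interior of `D` and to a
vacant square in the exterior of `D`; (c) every cycle of `G_C` containing the square in
its interior has all its edges on `D` or in the interior of `D`. -/
def isOutermostCycleOf (ω : GridV → Prop) (z : GridV) (D : Set (Sym2 GridV)) : Prop :=
  IsCycleIn (gcEdges ω) D ∧
  inInterior D (squareSet z) ∧
  (∀ e ∈ D,
    (∃ w ∈ starComp ω, e ∈ squareEdges w ∧ inInterior D (squareSet w)) ∧
    (∃ w, ¬ ω w ∧ e ∈ squareEdges w ∧ inExterior D (squareSet w))) ∧
  (∀ C, IsCycleIn (gcEdges ω) C → inInterior C (squareSet z) →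
    ∀ e ∈ C, e ∈ D ∨ inInterior D (edgeSeg e))

/-- The list of edges traversed by a walk given as a list of vertices. -/
def walkEdges (p : List GridV) : List (Sym2 GridV) :=
  List.zipWith (fun a b => s(a, b)) p p.tail

section Edges

/-- The horizontal unit edge whose left endpoint is `v`. -/
def hEdge (v : GridV) : Sym2 GridV := s(v, v + (1, 0))

/-- The vertical unit edge whose lower endpoint is `v`. -/
def vEdge (v : GridV) : Sym2 GridV := s(v, v + (0, 1))

/-- `e` is an edge of the full grid graph. -/
def IsGridEdge (e : Sym2 GridV) : Prop := ∃ v, e = hEdge v ∨ e = vEdge v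

lemma mem_squareEdges_iff {e : Sym2 GridV} {z : GridV} :
    e ∈ squareEdges z ↔
      e = hEdge z ∨ e = vEdge (z + (1, 0)) ∨ e = hEdge (z + (0, 1)) ∨ e = vEdge z := by
  have h1 : vEdge (z + (1, 0)) = s(z + (1, 0), z + (1, 1)) := by
    simp [vEdge, add_assoc]
  have h2 : hEdge (z + (0, 1)) = s(z + (1, 1), z + (0, 1)) := by
    rw [Sym2.eq_swap]; simp [hEdge, add_assoc]
  have h3 : vEdge z = s(z + (0, 1), z) := by rw [Sym2.eq_swap]; rfl
  rw [h1, h2, h3]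
  rfl

lemma hEdge_injective : Function.Injective hEdge := by
  rintro ⟨a, b⟩ ⟨c, d⟩ h
  simp only [hEdge, Sym2.eq_iff, Prod.mk_add_mk, Prod.mk.injEq] at h ⊢
  omega

lemma vEdge_injective : Function.Injective vEdge := by
  rintro ⟨a, b⟩ ⟨c, d⟩ h
  simp only [vEdge, Sym2.eq_iff, Prod.mk_add_mk, Prod.mk.injEq] at h ⊢
  omega

lemma hEdge_ne_vEdge (u v : GridV) : hEdge u ≠ vEdge v := by
  obtain ⟨a, b⟩ := u
  obtain ⟨c, d⟩ := v
  intro h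
  simp only [hEdge, vEdge, Sym2.eq_iff, Prod.mk_add_mk, Prod.mk.injEq] at h
  omega

lemma hEdge_mem_squareEdges {v w : GridV} :
    hEdge v ∈ squareEdges w ↔ w = v ∨ w = v - (0, 1) := by
  rw [mem_squareEdges_iff]
  simp only [hEdge_injective.eq_iff, hEdge_ne_vEdge, false_or, or_false, eq_sub_iff_add_eq]
  exact or_congr eq_comm eq_comm

lemma vEdge_mem_squareEdges {v w : GridV} :
    vEdge v ∈ squareEdges w ↔ w = v ∨ w = v - (1, 0) := by
  rw [mem_squareEdges_iff]
  simp only [vEdge_injective.eq_iff, (hEdge_ne_vEdge _ _).symm, false_or, eq_sub_iff_add_eq]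
  rw [or_comm]
  exact or_congr eq_comm eq_comm

lemma isGridEdge_of_mem_squareEdges {e : Sym2 GridV} {w : GridV} (h : e ∈ squareEdges w) :
    IsGridEdge e := by
  rcases mem_squareEdges_iff.1 h with h | h | h | h
  exacts [⟨_, .inl h⟩, ⟨_, .inr h⟩, ⟨_, .inl h⟩, ⟨_, .inr h⟩]

/-- A grid edge belongs to at most two squares. -/
lemma eq_or_eq_of_mem_squareEdges {e : Sym2 GridV} {a b c : GridV} (hab : a ≠ b)
    (ha : e ∈ squareEdges a) (hb : e ∈ squareEdges b) (hc : e ∈ squareEdges c) :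
    c = a ∨ c = b := by
  obtain ⟨v, rfl | rfl⟩ := isGridEdge_of_mem_squareEdges ha
  · rw [hEdge_mem_squareEdges] at ha hb hc
    grind
  · rw [vEdge_mem_squareEdges] at ha hb hc
    grind

lemma exists_eq_add_of_gridAdj {u v : GridV} (h : GridAdj u v) :
    v = u + (1, 0) ∨ v = u - (1, 0) ∨ v = u + (0, 1) ∨ v = u - (0, 1) := by
  obtain ⟨a, b⟩ := u
  obtain ⟨c, d⟩ := v
  simp only [GridAdj, Prod.mk_add_mk, Prod.mk_sub_mk, Prod.mk.injEq] at h ⊢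
  rcases abs_cases (a - c) with h1 | h1 <;> rcases abs_cases (b - d) with h2 | h2 <;> omega

lemma mk_sub_one_zero (u : GridV) : s(u, u - (1, 0)) = hEdge (u - (1, 0)) := by
  rw [Sym2.eq_swap, hEdge, sub_add_cancel]

lemma mk_sub_zero_one (u : GridV) : s(u, u - (0, 1)) = vEdge (u - (0, 1)) := by
  rw [Sym2.eq_swap, vEdge, sub_add_cancel]

lemma isGridEdge_of_gridAdj {u v : GridV} (h : GridAdj u v) : IsGridEdge s(u, v) := by
  rcases exists_eq_add_of_gridAdj h with rfl | rfl | rfl | rfl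
  exacts [⟨_, .inl rfl⟩, ⟨_, .inl (mk_sub_one_zero u)⟩, ⟨_, .inr rfl⟩,
    ⟨_, .inr (mk_sub_zero_one u)⟩]

lemma gridAdj_of_isGridEdge {u v : GridV} (h : IsGridEdge s(u, v)) : GridAdj u v := by
  obtain ⟨a, b⟩ := u
  obtain ⟨c, d⟩ := v
  obtain ⟨⟨x, y⟩, h | h⟩ := h <;>
    simp only [hEdge, vEdge, Sym2.eq_iff, Prod.mk_add_mk, Prod.mk.injEq, GridAdj] at h ⊢ <;>
    rcases abs_cases (a - c) with h1 | h1 <;> rcases abs_cases (b - d) with h2 | h2 <;> omega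

lemma isGridEdge_of_isCycle {E : Set (Sym2 GridV)} (hE : IsCycle E) {e : Sym2 GridV}
    (he : e ∈ E) : IsGridEdge e := by
  obtain ⟨C, rfl⟩ := hE
  obtain ⟨i, rfl⟩ := he
  exact isGridEdge_of_gridAdj (C.adj i)

end Edges

section Plane

lemma mem_squareSet {z : GridV} {p : ℝ × ℝ} :
    p ∈ squareSet z ↔ ((z.1 : ℝ) - 1 / 2 ≤ p.1 ∧ p.1 ≤ (z.1 : ℝ) + 1 / 2) ∧
      ((z.2 : ℝ) - 1 / 2 ≤ p.2 ∧ p.2 ≤ (z.2 : ℝ) + 1 / 2) := by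
  simp only [squareSet, Set.mem_Icc, Prod.le_def]
  tauto

lemma mem_edgeSeg_hEdge {v : GridV} {p : ℝ × ℝ} :
    p ∈ edgeSeg (hEdge v) ↔
      ((v.1 : ℝ) - 1 / 2 ≤ p.1 ∧ p.1 ≤ (v.1 : ℝ) + 1 / 2) ∧ p.2 = (v.2 : ℝ) - 1 / 2 := by
  have h : edgeSeg (hEdge v) =
      segment ℝ ((v.1 : ℝ) - 1 / 2, (v.2 : ℝ) - 1 / 2) ((v.1 : ℝ) + 1 / 2, (v.2 : ℝ) - 1 / 2) := by
    simp only [edgeSeg, hEdge, Sym2.lift_mk, toPlane, Prod.fst_add, Prod.snd_add, add_zero]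
    push_cast
    congr 2
    ring
  rw [h, ← Prod.image_mk_segment_left, segment_eq_Icc (by linarith)]
  obtain ⟨x, y⟩ := p
  simp only [Set.mem_image, Set.mem_Icc, Prod.mk.injEq]
  constructor
  · rintro ⟨t, ht, rfl, rfl⟩
    exact ⟨ht, rfl⟩
  · rintro ⟨ht, rfl⟩
    exact ⟨x, ht, rfl, rfl⟩

lemma mem_edgeSeg_vEdge {v : GridV} {p : ℝ × ℝ} :
    p ∈ edgeSeg (vEdge v) ↔
      p.1 = (v.1 : ℝ) - 1 / 2 ∧ ((v.2 : ℝ) - 1 / 2 ≤ p.2 ∧ p.2 ≤ (v.2 : ℝ) + 1 / 2) := by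
  have h : edgeSeg (vEdge v) =
      segment ℝ ((v.1 : ℝ) - 1 / 2, (v.2 : ℝ) - 1 / 2) ((v.1 : ℝ) - 1 / 2, (v.2 : ℝ) + 1 / 2) := by
    simp only [edgeSeg, vEdge, Sym2.lift_mk, toPlane, Prod.fst_add, Prod.snd_add, add_zero]
    push_cast
    congr 2
    ring
  rw [h, ← Prod.image_mk_segment_right, segment_eq_Icc (by linarith)]
  obtain ⟨x, y⟩ := p
  simp only [Set.mem_image, Set.mem_Icc, Prod.mk.injEq]
  constructor
  · rintro ⟨t, ht, rfl, rfl⟩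
    exact ⟨rfl, ht⟩
  · rintro ⟨rfl, ht⟩
    exact ⟨y, ht, rfl, rfl⟩

lemma edgeSeg_subset_squareSet {e : Sym2 GridV} {w : GridV} (h : e ∈ squareEdges w) :
    edgeSeg e ⊆ squareSet w := by
  intro p hp
  rw [mem_squareSet]
  rcases mem_squareEdges_iff.1 h with rfl | rfl | rfl | rfl <;>
    simp only [mem_edgeSeg_hEdge, mem_edgeSeg_vEdge, Prod.fst_add, Prod.snd_add] at hp <;>
    push_cast at hp <;> refine ⟨⟨?_, ?_⟩, ?_, ?_⟩ <;> linarith [hp.1, hp.2]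

/-- Every grid edge has a point lying on no other grid edge, namely its midpoint. -/
lemma exists_mem_edgeSeg_unique {e : Sym2 GridV} (he : IsGridEdge e) :
    ∃ m ∈ edgeSeg e, ∀ f, IsGridEdge f → m ∈ edgeSeg f → f = e := by
  obtain ⟨v, rfl | rfl⟩ := he
  · refine ⟨((v.1 : ℝ), (v.2 : ℝ) - 1 / 2), ?_, ?_⟩
    · rw [mem_edgeSeg_hEdge]
      exact ⟨⟨by simp, by simp⟩, rfl⟩
    · rintro _ ⟨u, rfl | rfl⟩ h
      · obtain ⟨⟨h1, h2⟩, h3⟩ := mem_edgeSeg_hEdge.1 h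
        have h1' : (u.1 : ℝ) < v.1 + 1 := by simp only at h1; linarith
        have h2' : (v.1 : ℝ) < u.1 + 1 := by simp only at h2; linarith
        have h3' : (v.2 : ℝ) = u.2 := by simp only at h3; linarith
        norm_cast at h1' h2' h3'
        rw [Prod.ext (show u.1 = v.1 by omega) h3'.symm]
      · obtain ⟨h1, -⟩ := mem_edgeSeg_vEdge.1 h
        have h1' : (2 * v.1 + 1 : ℝ) = 2 * u.1 := by simp only at h1; linarith
        norm_cast at h1'
        omega
  · refine ⟨((v.1 : ℝ) - 1 / 2, (v.2 : ℝ)), ?_, ?_⟩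
    · rw [mem_edgeSeg_vEdge]
      exact ⟨rfl, by simp, by simp⟩
    · rintro _ ⟨u, rfl | rfl⟩ h
      · obtain ⟨-, h1⟩ := mem_edgeSeg_hEdge.1 h
        have h1' : (2 * v.2 + 1 : ℝ) = 2 * u.2 := by simp only at h1; linarith
        norm_cast at h1'
        omega
      · obtain ⟨h3, h1, h2⟩ := mem_edgeSeg_vEdge.1 h
        have h1' : (u.2 : ℝ) < v.2 + 1 := by simp only at h1; linarith
        have h2' : (v.2 : ℝ) < u.2 + 1 := by simp only at h2; linarith
        have h3' : (v.1 : ℝ) = u.1 := by simp only at h3; linarith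
        norm_cast at h1' h2' h3'
        rw [Prod.ext h3'.symm (show u.2 = v.2 by omega)]

lemma mem_carrierOf {E : Set (Sym2 GridV)} {p : ℝ × ℝ} :
    p ∈ carrierOf E ↔ ∃ e ∈ E, p ∈ edgeSeg e := by
  simp [carrierOf]

/-- The open unit square of index `z`. -/
def openSquare (z : GridV) : Set (ℝ × ℝ) :=
  Set.Ioo ((z.1 : ℝ) - 1 / 2) ((z.1 : ℝ) + 1 / 2) ×ˢ
    Set.Ioo ((z.2 : ℝ) - 1 / 2) ((z.2 : ℝ) + 1 / 2)

lemma openSquare_disjoint_edgeSeg {e : Sym2 GridV} (he : IsGridEdge e) {z : GridV} {p : ℝ × ℝ}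
    (hp : p ∈ openSquare z) : p ∉ edgeSeg e := by
  obtain ⟨⟨h1, h2⟩, h3, h4⟩ := hp
  intro h
  obtain ⟨v, rfl | rfl⟩ := he
  · obtain ⟨-, h⟩ := mem_edgeSeg_hEdge.1 h
    rw [h] at h3 h4
    have h3' : (z.2 : ℝ) < v.2 := by linarith
    have h4' : (v.2 : ℝ) < z.2 + 1 := by linarith
    norm_cast at h3' h4'
    omega
  · obtain ⟨h, -⟩ := mem_edgeSeg_vEdge.1 h
    rw [h] at h1 h2
    have h3' : (z.1 : ℝ) < v.1 := by linarith
    have h4' : (v.1 : ℝ) < z.1 + 1 := by linarith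
    norm_cast at h3' h4'
    omega

variable {E : Set (Sym2 GridV)}

lemma openSquare_subset (hE : ∀ e ∈ E, IsGridEdge e) (z : GridV) :
    openSquare z ⊆ squareSet z \ carrierOf E := by
  intro p hp
  refine ⟨mem_squareSet.2 ⟨⟨hp.1.1.le, hp.1.2.le⟩, hp.2.1.le, hp.2.2.le⟩, fun h ↦ ?_⟩
  obtain ⟨e, he, h⟩ := mem_carrierOf.1 h
  exact openSquare_disjoint_edgeSeg (hE e he) hp h

lemma center_mem_openSquare (z : GridV) : ((z.1 : ℝ), (z.2 : ℝ)) ∈ openSquare z := by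
  refine ⟨⟨?_, ?_⟩, ?_, ?_⟩ <;> simp

lemma isPreconnected_squareSet_diff (hE : ∀ e ∈ E, IsGridEdge e) (z : GridV) :
    IsPreconnected (squareSet z \ carrierOf E) := by
  refine IsPreconnected.subset_closure (s := openSquare z) ?_ (openSquare_subset hE z) ?_
  · exact isPreconnected_Ioo.prod isPreconnected_Ioo
  · rw [openSquare, closure_prod_eq, closure_Ioo (by linarith), closure_Ioo (by linarith)]
    intro p hp
    exact mem_squareSet.1 hp.1

/-- Two squares share an edge that does not belong to `E`. -/
def AdjAvoiding (E : Set (Sym2 GridV)) (a b : GridV) : Prop :=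
  ∃ e, e ∉ E ∧ e ∈ squareEdges a ∧ e ∈ squareEdges b

lemma AdjAvoiding.symm {a b : GridV} (h : AdjAvoiding E a b) : AdjAvoiding E b a := by
  obtain ⟨e, h, ha, hb⟩ := h
  exact ⟨e, h, hb, ha⟩

/-- The squares that can be reached from `a` without crossing an edge of `E`. -/
def squareClass (E : Set (Sym2 GridV)) (a : GridV) : Set GridV :=
  {b | Relation.ReflTransGen (AdjAvoiding E) a b}

lemma self_mem_squareClass (a : GridV) : a ∈ squareClass E a := Relation.ReflTransGen.refl

lemma squareClass_symm {a b : GridV} (h : b ∈ squareClass E a) : a ∈ squareClass E b := by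
  induction h with
  | refl => exact .refl
  | tail _ hbc ih => exact .head hbc.symm ih

lemma squareClass_subset_of_mem {a b : GridV} (h : b ∈ squareClass E a) :
    squareClass E b ⊆ squareClass E a :=
  fun _ hc ↦ Relation.ReflTransGen.trans h hc

lemma squareClass_eq_of_mem {a b : GridV} (h : b ∈ squareClass E a) :
    squareClass E b = squareClass E a :=
  (squareClass_subset_of_mem h).antisymm (squareClass_subset_of_mem (squareClass_symm h))

lemma squareClass_anti {E' : Set (Sym2 GridV)} (h : E ⊆ E') (a : GridV) :
    squareClass E' a ⊆ squareClass E a :=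
  fun _ hb ↦ Relation.ReflTransGen.mono
    (fun _ _ ⟨e, he, h1, h2⟩ ↦ ⟨e, fun h' ↦ he (h h'), h1, h2⟩) _ _ hb

lemma mem_connectedComponentIn_of_mem_squareClass (hE : ∀ e ∈ E, IsGridEdge e) {a b : GridV}
    (hab : b ∈ squareClass E a) {p q : ℝ × ℝ} (hp : p ∈ squareSet a \ carrierOf E)
    (hq : q ∈ squareSet b \ carrierOf E) :
    q ∈ connectedComponentIn (carrierOf E)ᶜ p := by
  have key : ∀ (c : GridV) (x y : ℝ × ℝ), x ∈ squareSet c \ carrierOf E →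
      y ∈ squareSet c \ carrierOf E → y ∈ connectedComponentIn (carrierOf E)ᶜ x :=
    fun c x y hx hy ↦ (isPreconnected_squareSet_diff hE c).subset_connectedComponentIn hx
      (fun t ht ↦ ht.2) hy
  induction hab generalizing q with
  | refl => exact key a p q hp hq
  | @tail c d _ hcd ih =>
    obtain ⟨e, heE, hc, hd⟩ := hcd
    obtain ⟨m, hm, hm'⟩ := exists_mem_edgeSeg_unique (isGridEdge_of_mem_squareEdges hc)
    have hmE : m ∉ carrierOf E := by
      intro h
      obtain ⟨f, hf, hmf⟩ := mem_carrierOf.1 h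
      exact heE (hm' f (hE f hf) hmf ▸ hf)
    rw [connectedComponentIn_eq (ih ⟨edgeSeg_subset_squareSet hc hm, hmE⟩)]
    exact key d m q ⟨edgeSeg_subset_squareSet hd hm, hmE⟩ hq

lemma inExterior_of_infinite (hE : ∀ e ∈ E, IsGridEdge e) {a : GridV}
    (ha : (squareClass E a).Infinite) : inExterior E (squareSet a) := by
  intro p hp
  by_cases hpE : p ∈ carrierOf E
  · exact .inr hpE
  refine .inl ⟨hpE, fun hb ↦ ha ?_⟩
  obtain ⟨R, hR⟩ := hb.subset_closedBall 0
  obtain ⟨M, hM⟩ := exists_nat_ge R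
  refine (Set.finite_Icc (-(M : ℤ), -(M : ℤ)) ((M : ℤ), (M : ℤ))).subset fun b hb ↦ ?_
  have h := hR (mem_connectedComponentIn_of_mem_squareClass hE hb ⟨hp, hpE⟩
    (openSquare_subset hE b (center_mem_openSquare b)))
  rw [mem_closedBall_zero_iff, Prod.norm_def, max_le_iff] at h
  simp only [Real.norm_eq_abs, abs_le] at h
  obtain ⟨⟨h1, h2⟩, h3, h4⟩ := h
  have h1' : -(M : ℝ) ≤ b.1 := by linarith
  have h2' : (b.1 : ℝ) ≤ M := by linarith
  have h3' : -(M : ℝ) ≤ b.2 := by linarith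
  have h4' : (b.2 : ℝ) ≤ M := by linarith
  exact ⟨⟨by exact_mod_cast h1', by exact_mod_cast h3'⟩,
    ⟨by exact_mod_cast h2', by exact_mod_cast h4'⟩⟩

lemma locallyFinite_squareSet : LocallyFinite squareSet := by
  intro p
  refine ⟨Metric.ball p 1, Metric.ball_mem_nhds p one_pos, ?_⟩
  refine (Set.finite_Icc (⌊p.1⌋ - 2, ⌊p.2⌋ - 2) (⌊p.1⌋ + 3, ⌊p.2⌋ + 3)).subset ?_
  rintro w ⟨q, hq, hqp⟩
  rw [mem_squareSet] at hq
  rw [Metric.mem_ball, Prod.dist_eq, max_lt_iff] at hqp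
  simp only [Real.dist_eq, abs_lt] at hqp
  obtain ⟨⟨h1, h2⟩, h3, h4⟩ := hq
  obtain ⟨⟨g1, g2⟩, g3, g4⟩ := hqp
  have f1 := Int.floor_le p.1
  have f2 := Int.lt_floor_add_one p.1
  have f3 := Int.floor_le p.2
  have f4 := Int.lt_floor_add_one p.2
  refine ⟨⟨?_, ?_⟩, ?_, ?_⟩
  · have : ((⌊p.1⌋ - 2 : ℤ) : ℝ) ≤ w.1 := by push_cast; linarith
    exact_mod_cast this
  · have : ((⌊p.2⌋ - 2 : ℤ) : ℝ) ≤ w.2 := by push_cast; linarith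
    exact_mod_cast this
  · have : (w.1 : ℝ) ≤ ((⌊p.1⌋ + 3 : ℤ) : ℝ) := by push_cast; linarith
    exact_mod_cast this
  · have : (w.2 : ℝ) ≤ ((⌊p.2⌋ + 3 : ℤ) : ℝ) := by push_cast; linarith
    exact_mod_cast this

lemma isClosed_squareSet (z : GridV) : IsClosed (squareSet z) := isClosed_Icc

lemma isClosed_biUnion_squareSet (K : Set GridV) : IsClosed (⋃ z ∈ K, squareSet z) := by
  rw [Set.biUnion_eq_iUnion]
  exact (locallyFinite_squareSet.comp_injective Subtype.val_injective).isClosed_iUnion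
    fun z ↦ isClosed_squareSet z

lemma exists_mem_squareSet (p : ℝ × ℝ) : ∃ z, p ∈ squareSet z := by
  refine ⟨(⌊p.1 + 1 / 2⌋, ⌊p.2 + 1 / 2⌋), mem_squareSet.2 ?_⟩
  have f1 := Int.floor_le (p.1 + 1 / 2)
  have f2 := Int.lt_floor_add_one (p.1 + 1 / 2)
  have f3 := Int.floor_le (p.2 + 1 / 2)
  have f4 := Int.lt_floor_add_one (p.2 + 1 / 2)
  refine ⟨⟨?_, ?_⟩, ?_, ?_⟩ <;> simp only <;> linarith

lemma eq_or_eq_add_one_of_mem_Icc {a b : ℤ} {x : ℝ}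
    (ha : (a : ℝ) - 1 / 2 ≤ x ∧ x ≤ (a : ℝ) + 1 / 2)
    (hb : (b : ℝ) - 1 / 2 ≤ x ∧ x ≤ (b : ℝ) + 1 / 2) : a = b ∨ b = a + 1 ∨ a = b + 1 := by
  have h1 : (a : ℝ) ≤ b + 1 := by linarith [ha.1, hb.2]
  have h2 : (b : ℝ) ≤ a + 1 := by linarith [hb.1, ha.2]
  norm_cast at h1 h2
  omega

lemma adjAvoiding_of_hEdge {v : GridV} (h : hEdge v ∉ E) : AdjAvoiding E v (v - (0, 1)) :=
  ⟨_, h, hEdge_mem_squareEdges.2 (.inl rfl), hEdge_mem_squareEdges.2 (.inr rfl)⟩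

lemma adjAvoiding_of_vEdge {v : GridV} (h : vEdge v ∉ E) : AdjAvoiding E v (v - (1, 0)) :=
  ⟨_, h, vEdge_mem_squareEdges.2 (.inl rfl), vEdge_mem_squareEdges.2 (.inr rfl)⟩

lemma mem_squareClass_of_mem_squareSet {a b : GridV} {p : ℝ × ℝ} (ha : p ∈ squareSet a)
    (hb : p ∈ squareSet b) (hp : p ∉ carrierOf E) : b ∈ squareClass E a := by
  have hp' : ∀ e, p ∈ edgeSeg e → e ∉ E := fun e h he ↦ hp (mem_carrierOf.2 ⟨e, he, h⟩)
  have vert : ∀ (x y : ℤ), p ∈ squareSet (x, y) → p ∈ squareSet (x, y + 1) →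
      AdjAvoiding E (x, y + 1) (x, y) := by
    intro x y h1 h2
    have := adjAvoiding_of_hEdge (E := E) (v := (x, y + 1)) (hp' _ ?_)
    · simpa using this
    rw [mem_squareSet] at h1 h2
    rw [mem_edgeSeg_hEdge]
    refine ⟨h1.1, ?_⟩
    have h3 := h1.2.2
    have h4 := h2.2.1
    push_cast at *
    linarith
  have horiz : ∀ (x y : ℤ), p ∈ squareSet (x, y) → p ∈ squareSet (x + 1, y) →
      AdjAvoiding E (x + 1, y) (x, y) := by
    intro x y h1 h2
    have := adjAvoiding_of_vEdge (E := E) (v := (x + 1, y)) (hp' _ ?_)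
    · simpa using this
    rw [mem_squareSet] at h1 h2
    rw [mem_edgeSeg_vEdge]
    refine ⟨?_, h1.2⟩
    have h3 := h1.1.2
    have h4 := h2.1.1
    push_cast at *
    linarith
  obtain ⟨x, y⟩ := a
  obtain ⟨x', y'⟩ := b
  have hc : p ∈ squareSet (x, y') := by
    rw [mem_squareSet] at ha hb ⊢
    exact ⟨ha.1, hb.2⟩
  have h1 : (x, y') ∈ squareClass E (x, y) := by
    rcases eq_or_eq_add_one_of_mem_Icc (mem_squareSet.1 ha).2 (mem_squareSet.1 hc).2 with
      h | h | h <;> simp only at h <;> subst h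
    · exact self_mem_squareClass _
    · exact .single (vert _ _ ha hc).symm
    · exact .single (vert _ _ hc ha)
  refine squareClass_subset_of_mem h1 ?_
  rcases eq_or_eq_add_one_of_mem_Icc (mem_squareSet.1 hc).1 (mem_squareSet.1 hb).1 with
    h | h | h <;> simp only at h <;> subst h
  · exact self_mem_squareClass _
  · exact .single (horiz _ _ hc hb).symm
  · exact .single (horiz _ _ hb hc)

lemma inInterior_of_finite {a : GridV} (ha : (squareClass E a).Finite) :
    inInterior E (squareSet a) := by
  intro p hp
  by_cases hpE : p ∈ carrierOf E
  · exact .inr hpE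
  refine .inl ⟨hpE, ?_⟩
  have hbdd : Bornology.IsBounded (⋃ z ∈ squareClass E a, squareSet z) :=
    (Bornology.isBounded_biUnion ha).2 fun z _ ↦ Metric.isBounded_Icc _ _
  refine hbdd.subset ?_
  have hpT : p ∈ ⋃ z ∈ squareClass E a, squareSet z :=
    Set.mem_biUnion (self_mem_squareClass a) hp
  have hdisj : ∀ q ∈ (⋃ z ∈ squareClass E a, squareSet z) ∩ ⋃ z ∈ (squareClass E a)ᶜ, squareSet z,
      q ∈ carrierOf E := by
    rintro q ⟨h1, h2⟩
    by_contra hq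
    simp only [Set.mem_iUnion, exists_prop] at h1 h2
    obtain ⟨b, hb, hqb⟩ := h1
    obtain ⟨c, hc, hqc⟩ := h2
    exact hc (squareClass_subset_of_mem hb (mem_squareClass_of_mem_squareSet hqb hqc hq))
  refine (isPreconnected_iff_subset_of_disjoint_closed.1
    (isPreconnected_connectedComponentIn (F := (carrierOf E)ᶜ) (x := p)) _ _
    (isClosed_biUnion_squareSet (squareClass E a)) (isClosed_biUnion_squareSet (squareClass E a)ᶜ)
    ?_ ?_).resolve_right fun h ↦ hpE (hdisj p ⟨hpT, h (mem_connectedComponentIn hpE)⟩)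
  · intro q _
    obtain ⟨z, hz⟩ := exists_mem_squareSet q
    by_cases hza : z ∈ squareClass E a
    · exact .inl (Set.mem_biUnion hza hz)
    · exact .inr (Set.mem_biUnion hza hz)
  · rw [Set.eq_empty_iff_forall_notMem]
    rintro q ⟨h1, h2⟩
    exact connectedComponentIn_subset _ _ h1 (hdisj q h2)

lemma mem_carrierOf_of_mem_of_mem {A B : Set (ℝ × ℝ)} (hA : inInterior E A) (hB : inExterior E B)
    {p : ℝ × ℝ} (hpA : p ∈ A) (hpB : p ∈ B) : p ∈ carrierOf E := by
  rcases hA hpA with h | h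
  · rcases hB hpB with h' | h'
    · exact absurd h.2 h'.2
    · exact h'
  · exact h

lemma not_inInterior_of_inExterior (hE : ∀ e ∈ E, IsGridEdge e) {a : GridV}
    (h : inInterior E (squareSet a)) (h' : inExterior E (squareSet a)) : False := by
  have hc := openSquare_subset hE a (center_mem_openSquare a)
  exact hc.2 (mem_carrierOf_of_mem_of_mem h h' hc.1 hc.1)

lemma inInterior_squareSet_iff (hE : ∀ e ∈ E, IsGridEdge e) {a : GridV} :
    inInterior E (squareSet a) ↔ (squareClass E a).Finite := by
  refine ⟨fun h ↦ ?_, inInterior_of_finite⟩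
  by_contra hinf
  exact not_inInterior_of_inExterior hE h (inExterior_of_infinite hE hinf)

lemma inExterior_squareSet_iff (hE : ∀ e ∈ E, IsGridEdge e) {a : GridV} :
    inExterior E (squareSet a) ↔ (squareClass E a).Infinite :=
  ⟨fun h hfin ↦ not_inInterior_of_inExterior hE (inInterior_of_finite hfin) h,
    inExterior_of_infinite hE⟩

lemma mem_of_edgeSeg_inInterior_of_infinite (hE : ∀ e ∈ E, IsGridEdge e) {a : GridV}
    (ha : (squareClass E a).Infinite) {e : Sym2 GridV} (he : e ∈ squareEdges a)
    (hint : inInterior E (edgeSeg e)) : e ∈ E := by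
  obtain ⟨m, hm, hm'⟩ := exists_mem_edgeSeg_unique (isGridEdge_of_mem_squareEdges he)
  obtain ⟨f, hf, hmf⟩ := mem_carrierOf.1 (mem_carrierOf_of_mem_of_mem hint
    (inExterior_of_infinite hE ha) hm (edgeSeg_subset_squareSet he hm))
  exact hm' f (hE f hf) hmf ▸ hf

end Plane

section Boundary

/-- The edges separating a square of `A` from a square outside `A`. -/
def boundaryEdges (A : Set GridV) : Set (Sym2 GridV) :=
  {e | ∃ a ∈ A, ∃ b ∉ A, e ∈ squareEdges a ∧ e ∈ squareEdges b}

lemma hEdge_mem_boundaryEdges {A : Set GridV} {v : GridV} :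
    hEdge v ∈ boundaryEdges A ↔ ¬(v ∈ A ↔ v - (0, 1) ∈ A) := by
  simp only [boundaryEdges, Set.mem_ofPred_eq, hEdge_mem_squareEdges]
  grind

lemma vEdge_mem_boundaryEdges {A : Set GridV} {v : GridV} :
    vEdge v ∈ boundaryEdges A ↔ ¬(v ∈ A ↔ v - (1, 0) ∈ A) := by
  simp only [boundaryEdges, Set.mem_ofPred_eq, vEdge_mem_squareEdges]
  grind

lemma isGridEdge_of_mem_boundaryEdges {A : Set GridV} {e : Sym2 GridV}
    (he : e ∈ boundaryEdges A) : IsGridEdge e := by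
  obtain ⟨a, -, -, -, h, -⟩ := he
  exact isGridEdge_of_mem_squareEdges h

lemma finite_boundaryEdges {A : Set GridV} (hA : A.Finite) : (boundaryEdges A).Finite := by
  refine (hA.biUnion (t := squareEdges) fun a _ ↦ ?_).subset ?_
  · unfold squareEdges
    exact Set.toFinite _
  · rintro e ⟨a, ha, -, -, h, -⟩
    exact Set.mem_biUnion ha h

/-- Every edge of `E` can be continued at each of its endpoints by another edge of `E`. -/
def HasNoLeaf (E : Set (Sym2 GridV)) : Prop :=
  ∀ u v, s(u, v) ∈ E → ∃ w ≠ u, s(v, w) ∈ E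

lemma hasNoLeaf_boundaryEdges (A : Set GridV) : HasNoLeaf (boundaryEdges A) := by
  intro u v huv
  by_contra! h
  rw [Sym2.eq_swap] at huv
  have hadj := gridAdj_of_isGridEdge (isGridEdge_of_mem_boundaryEdges huv)
  have e1 := hEdge_mem_boundaryEdges (A := A) (v := v)
  have e2 := hEdge_mem_boundaryEdges (A := A) (v := v - (1, 0))
  have e3 := vEdge_mem_boundaryEdges (A := A) (v := v)
  have e4 := vEdge_mem_boundaryEdges (A := A) (v := v - (0, 1))
  rw [← mk_sub_one_zero] at e2
  rw [← mk_sub_zero_one, sub_right_comm] at e4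
  rw [hEdge] at e1
  rw [vEdge] at e3
  have f1 := h (v + (1, 0))
  have f2 := h (v - (1, 0))
  have f3 := h (v + (0, 1))
  have f4 := h (v - (0, 1))
  have n12 : v + (1, 0) ≠ v - (1, 0) := by simp [Prod.ext_iff]; omega
  have n13 : v + (1, 0) ≠ v + (0, 1) := by simp
  have n14 : v + (1, 0) ≠ v - (0, 1) := by simp [Prod.ext_iff]
  have n23 : v - (1, 0) ≠ v + (0, 1) := by simp [Prod.ext_iff]
  have n24 : v - (1, 0) ≠ v - (0, 1) := by simp
  have n34 : v + (0, 1) ≠ v - (0, 1) := by simp [Prod.ext_iff]; omega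
  rcases exists_eq_add_of_gridAdj hadj with rfl | rfl | rfl | rfl
  · have := f2 n12.symm
    have := f3 n13.symm
    have := f4 n14.symm
    grind
  · have := f1 n12
    have := f3 n23.symm
    have := f4 n24.symm
    grind
  · have := f1 n13
    have := f2 n23
    have := f4 n34.symm
    grind
  · have := f1 n14
    have := f2 n24
    have := f3 n34
    grind

/-- A path of squares leaving `K` crosses the boundary of `K`. -/
lemma exists_crossing {E : Set (Sym2 GridV)} {K : Set GridV} {a b : GridV}
    (hab : b ∈ squareClass E a) (ha : a ∈ K) (hb : b ∉ K) :
    ∃ c ∈ K, ∃ d ∉ K, c ∈ squareClass E a ∧ ∃ e, e ∉ E ∧ e ∈ squareEdges c ∧ e ∈ squareEdges d := by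
  induction hab with
  | refl => exact absurd ha hb
  | @tail c d hac hcd ih =>
    by_cases hc : c ∈ K
    · exact ⟨c, hc, d, hb, hac, hcd⟩
    · exact ih hc

lemma boundaryEdges_squareClass_subset {E : Set (Sym2 GridV)} {a : GridV} :
    boundaryEdges (squareClass E a) ⊆ E := by
  rintro e ⟨c, hc, d, hd, hec, hed⟩
  by_contra he
  exact hd (Relation.ReflTransGen.tail hc ⟨e, he, hec, hed⟩)

end Boundary

section Cycles

lemma two_ne_zero_zmod {n : ℕ} (hn : 3 ≤ n) : (2 : ZMod n) ≠ 0 := by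
  intro h
  have h' : ((2 : ℕ) : ZMod n) = 0 := by exact_mod_cast h
  rw [ZMod.natCast_eq_zero_iff] at h'
  exact absurd (Nat.le_of_dvd two_pos h') (by omega)

lemma GridCycle.mk_mem_edgeSet_iff (C : GridCycle) (i : ZMod C.n) (w : GridV) :
    s(C.f i, w) ∈ C.edgeSet ↔ w = C.f (i - 1) ∨ w = C.f (i + 1) := by
  constructor
  · rintro ⟨j, hj⟩
    rcases Sym2.eq_iff.1 hj with ⟨h1, h2⟩ | ⟨h1, h2⟩
    · right
      rw [h2, C.inj h1]
    · left
      rw [h2, C.inj h1, add_sub_cancel_right]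
  · rintro (rfl | rfl)
    · exact ⟨i - 1, by rw [Sym2.eq_swap, sub_add_cancel]⟩
    · exact ⟨i, rfl⟩

lemma GridCycle.exists_f_eq (C : GridCycle) {v w : GridV} (h : s(v, w) ∈ C.edgeSet) :
    ∃ i, C.f i = v := by
  obtain ⟨j, hj⟩ := h
  rcases Sym2.eq_iff.1 hj with ⟨h1, -⟩ | ⟨h1, -⟩
  exacts [⟨_, h1.symm⟩, ⟨_, h1.symm⟩]

lemma GridCycle.nonempty_edgeSet (C : GridCycle) : C.edgeSet.Nonempty := ⟨_, 0, rfl⟩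

/-- A cycle contains no proper nonempty edge set without leaves. -/
lemma GridCycle.eq_edgeSet_of_hasNoLeaf (C : GridCycle) {E : Set (Sym2 GridV)}
    (hE : E ⊆ C.edgeSet) (hne : E.Nonempty) (hleaf : HasNoLeaf E) : E = C.edgeSet := by
  refine hE.antisymm ?_
  have : NeZero C.n := ⟨by have := C.hn; omega⟩
  obtain ⟨e, he⟩ := hne
  obtain ⟨i, rfl⟩ := hE he
  have key : ∀ k : ℕ, s(C.f (i + k), C.f (i + k + 1)) ∈ E := by
    intro k
    induction k with
    | zero => simpa using he
    | succ k ih =>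
      obtain ⟨w, hw, hwE⟩ := hleaf _ _ ih
      rcases (C.mk_mem_edgeSet_iff _ _).1 (hE hwE) with h | h
      · rw [add_sub_cancel_right] at h
        exact absurd h hw
      · rw [h] at hwE
        push_cast
        rwa [← add_assoc]
  rintro _ ⟨j, rfl⟩
  have := key (j - i).val
  rwa [ZMod.natCast_zmod_val, add_sub_cancel] at this

/-- A nonempty finite set of grid edges without leaves contains a cycle. -/
lemma exists_gridCycle_of_hasNoLeaf {E : Set (Sym2 GridV)} (hgrid : ∀ e ∈ E, IsGridEdge e)
    (hfin : E.Finite) (hne : E.Nonempty) (hleaf : HasNoLeaf E) :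
    ∃ C : GridCycle, C.edgeSet ⊆ E := by
  classical
  choose! nxt hnxt hnxt' using hleaf
  obtain ⟨e, he⟩ := hne
  induction e using Sym2.ind with | _ a b =>
  let q : ℕ → GridV × GridV := fun k ↦ (fun p : GridV × GridV ↦ (p.2, nxt p.1 p.2))^[k] (a, b)
  have hq : ∀ k, q (k + 1) = ((q k).2, nxt (q k).1 (q k).2) := fun k ↦
    Function.iterate_succ_apply' _ _ _
  have hqE : ∀ k, s((q k).1, (q k).2) ∈ E := by
    intro k
    induction k with
    | zero => exact he
    | succ k ih =>
      rw [hq]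
      exact hnxt' _ _ ih
  let g : ℕ → GridV := fun k ↦ (q k).1
  have hg1 : ∀ k, g (k + 1) = (q k).2 := fun k ↦ by simp only [g, hq]
  have hgE : ∀ k, s(g k, g (k + 1)) ∈ E := fun k ↦ by rw [hg1]; exact hqE k
  have hgadj : ∀ k, GridAdj (g k) (g (k + 1)) := fun k ↦ gridAdj_of_isGridEdge (hgrid _ (hgE k))
  have hg2 : ∀ k, g (k + 2) ≠ g k := fun k ↦ by
    rw [hg1 (k + 1), hq]
    exact hnxt _ _ (hqE k)
  have hgfin : (Set.range g).Finite := by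
    refine (hfin.biUnion (t := fun e ↦ {v | v ∈ e}) fun e _ ↦ ?_).subset ?_
    · induction e using Sym2.ind with | _ x y =>
      exact (Set.toFinite {x, y}).subset fun v hv ↦ by simpa using hv
    · rintro _ ⟨k, rfl⟩
      exact Set.mem_biUnion (hgE k) (Sym2.mem_mk_left _ _)
  have hrep : ∃ m, 0 < m ∧ ∃ i, g i = g (i + m) := by
    have : ¬ Function.Injective g := fun h ↦ Set.infinite_range_of_injective h hgfin
    simp only [Function.Injective, not_forall] at this
    obtain ⟨i, j, hij, hne⟩ := this
    rcases lt_or_gt_of_ne hne with h | h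
    · exact ⟨j - i, by omega, i, by rw [hij]; congr 1; omega⟩
    · exact ⟨i - j, by omega, j, by rw [← hij]; congr 1; omega⟩
  obtain ⟨hm0, i, hi⟩ := Nat.find_spec hrep
  set m := Nat.find hrep with hm
  have hmin : ∀ k, 0 < k → (∃ i, g i = g (i + k)) → m ≤ k := fun k h1 h2 ↦
    Nat.find_min' hrep ⟨h1, h2⟩
  have hm3 : 3 ≤ m := by
    by_contra hlt
    have : m = 1 ∨ m = 2 := by omega
    rcases this with h | h
    · have := hgadj i
      rw [h] at hi
      rw [← hi] at this
      simp [GridAdj] at this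
    · rw [h] at hi
      exact hg2 i hi.symm
  have : NeZero m := ⟨by omega⟩
  have hsucc : ∀ k : ZMod m, g (i + (k + 1).val) = g (i + k.val + 1) := by
    intro k
    have hk := ZMod.val_lt k
    have : Fact (1 < m) := ⟨by omega⟩
    rcases Nat.lt_or_ge (k.val + 1) m with h | h
    · rw [ZMod.val_add_of_lt (by rwa [ZMod.val_one]), ZMod.val_one, add_assoc]
    · have h1 : k + 1 = 0 := by
        rw [← ZMod.natCast_zmod_val k]
        have : ((k.val + 1 : ℕ) : ZMod m) = 0 := by
          rw [show k.val + 1 = m by omega, ZMod.natCast_self]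
        exact_mod_cast this
      rw [h1, ZMod.val_zero, add_zero, hi]
      congr 1
      omega
  refine ⟨⟨m, hm3, fun k ↦ g (i + k.val), ?_, ?_⟩, ?_⟩
  · have hlt : ∀ k l : ZMod m, k.val < l.val → g (i + k.val) ≠ g (i + l.val) := by
      intro k l hkl h
      have := hmin (l.val - k.val) (by omega) ⟨i + k.val, by rw [h]; congr 1; omega⟩
      have := ZMod.val_lt l
      omega
    intro k l hkl
    rcases lt_trichotomy k.val l.val with h | h | h
    · exact absurd hkl (hlt _ _ h)
    · exact ZMod.val_injective m h
    · exact absurd hkl.symm (hlt _ _ h)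
  · intro k
    rw [hsucc]
    exact hgadj _
  · rintro _ ⟨k, rfl⟩
    have h := hgE (i + (k : ZMod m).val)
    rw [← hsucc] at h
    exact h

open Classical in
/-- The indicator of an edge set, with values in `ZMod 2`. -/
noncomputable def edgeInd (E : Set (Sym2 GridV)) (e : Sym2 GridV) : ZMod 2 :=
  if e ∈ E then 1 else 0

lemma GridCycle.sum_edgeInd_eq_zero (C : GridCycle) (v : GridV) :
    edgeInd C.edgeSet (hEdge v) + edgeInd C.edgeSet (hEdge (v - (1, 0))) +
      edgeInd C.edgeSet (vEdge v) + edgeInd C.edgeSet (vEdge (v - (0, 1))) = 0 := by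
  classical
  rw [← mk_sub_one_zero, ← mk_sub_zero_one, hEdge, vEdge]
  simp only [edgeInd]
  by_cases hv : ∃ i, C.f i = v
  · obtain ⟨i, rfl⟩ := hv
    simp only [C.mk_mem_edgeSet_iff]
    have h1 := C.adj (i - 1)
    have h2 := C.adj i
    have hne : C.f (i - 1) ≠ C.f (i + 1) := by
      intro h
      have h := C.inj h
      apply two_ne_zero_zmod C.hn
      linear_combination -h
    rw [sub_add_cancel] at h1
    have h1' : GridAdj (C.f i) (C.f (i - 1)) := by
      simpa only [GridAdj, abs_sub_comm] using h1
    generalize C.f i = v at *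
    generalize C.f (i - 1) = a at *
    generalize C.f (i + 1) = b at *
    obtain ⟨x, y⟩ := v
    have t1 : (x + 1 = x - 1) = False := by simp; omega
    have t2 : (x - 1 = x + 1) = False := by simp; omega
    have t3 : (y + 1 = y - 1) = False := by simp; omega
    have t4 : (y - 1 = y + 1) = False := by simp; omega
    rcases exists_eq_add_of_gridAdj h1' with rfl | rfl | rfl | rfl <;>
      rcases exists_eq_add_of_gridAdj h2 with rfl | rfl | rfl | rfl <;>
      first
      | exact absurd rfl hne
      | (simp [t1, t2, t3, t4]; try decide)
  · have hv' : ∀ w, s(v, w) ∉ C.edgeSet := fun w h ↦ hv (C.exists_f_eq h)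
    simp [hv']

lemma GridCycle.exists_bound (C : GridCycle) :
    ∃ M : ℤ, ∀ v w, s(v, w) ∈ C.edgeSet → v.1 < M := by
  have : NeZero C.n := ⟨by have := C.hn; omega⟩
  obtain ⟨M, hM⟩ := (Set.finite_range fun i ↦ (C.f i).1).bddAbove
  refine ⟨M + 1, fun v w h ↦ ?_⟩
  obtain ⟨i, rfl⟩ := C.exists_f_eq h
  have := hM ⟨i, rfl⟩
  simp only at this
  omega

lemma zmod_two_ne_iff (a b : ZMod 2) : a ≠ b ↔ a + b = 1 := by
  revert a b
  decide

lemma edgeInd_eq_one {E : Set (Sym2 GridV)} {e : Sym2 GridV} : edgeInd E e = 1 ↔ e ∈ E := by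
  classical
  simp [edgeInd]

/-- A cycle separates the squares into two classes such that crossing an edge changes the class
if and only if the edge belongs to the cycle. -/
lemma GridCycle.exists_parity (C : GridCycle) :
    ∃ p : GridV → ZMod 2, ∀ a b e, a ≠ b → e ∈ squareEdges a → e ∈ squareEdges b →
      (p a ≠ p b ↔ e ∈ C.edgeSet) := by
  classical
  obtain ⟨M, hM⟩ := C.exists_bound
  have hh : ∀ v : GridV, M ≤ v.1 → edgeInd C.edgeSet (hEdge v) = 0 := fun v hv ↦
    if_neg fun h ↦ absurd (hM _ _ h) (not_lt.2 hv)
  have hvv : ∀ v : GridV, M ≤ v.1 → edgeInd C.edgeSet (vEdge v) = 0 := fun v hv ↦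
    if_neg fun h ↦ absurd (hM _ _ h) (not_lt.2 hv)
  let p : GridV → ZMod 2 := fun v ↦
    ∑ i ∈ Finset.range (M - v.1).toNat, edgeInd C.edgeSet (vEdge (v.1 + 1 + i, v.2))
  have h0 : ∀ v : GridV, M ≤ v.1 → p v = 0 := by
    intro v hv
    simp only [p]
    rw [Int.toNat_of_nonpos (by omega), Finset.sum_range_zero]
  have hx : ∀ x y : ℤ, p (x, y) = edgeInd C.edgeSet (vEdge (x + 1, y)) + p (x + 1, y) := by
    intro x y
    rcases lt_or_ge x M with h | h
    · simp only [p]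
      rw [show (M - x).toNat = (M - (x + 1)).toNat + 1 by omega, Finset.sum_range_succ', add_comm]
      congr 1
      · simp
      · refine Finset.sum_congr rfl fun i _ ↦ ?_
        push_cast
        rw [show x + 1 + ((i : ℤ) + 1) = x + 1 + 1 + i by ring]
    · rw [h0 _ h, h0 _ (show M ≤ x + 1 by omega), hvv _ (show M ≤ x + 1 by omega), add_zero]
  have hy : ∀ (k : ℕ) (x y : ℤ), M - x ≤ k →
      p (x, y) + p (x, y - 1) = edgeInd C.edgeSet (hEdge (x, y)) := by
    intro k
    induction k with
    | zero =>
      intro x y hk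
      have hk' : M ≤ x := by push_cast at hk; omega
      rw [h0 _ hk', h0 _ hk', hh _ hk', add_zero]
    | succ k ih =>
      intro x y hk
      have h1 := ih (x + 1) y (by push_cast at hk; omega)
      have h2 := C.sum_edgeInd_eq_zero (x + 1, y)
      simp only [Prod.mk_sub_mk, sub_zero, add_sub_cancel_right] at h2
      rw [hx x y, hx x (y - 1)]
      generalize p (x + 1, y) = p1 at *
      generalize p (x + 1, y - 1) = p2 at *
      generalize edgeInd C.edgeSet (vEdge (x + 1, y)) = i1 at *
      generalize edgeInd C.edgeSet (vEdge (x + 1, y - 1)) = i2 at *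
      generalize edgeInd C.edgeSet (hEdge (x + 1, y)) = i3 at *
      generalize edgeInd C.edgeSet (hEdge (x, y)) = i4 at *
      revert p1 p2 i1 i2 i3 i4
      decide
  have hH : ∀ v : GridV, p v ≠ p (v - (0, 1)) ↔ hEdge v ∈ C.edgeSet := by
    rintro ⟨x, y⟩
    rw [zmod_two_ne_iff, ← edgeInd_eq_one, ← hy (M - x).toNat x y (by omega)]
    simp
  have hV : ∀ v : GridV, p v ≠ p (v - (1, 0)) ↔ vEdge v ∈ C.edgeSet := by
    rintro ⟨x, y⟩
    have h := hx (x - 1) y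
    rw [sub_add_cancel] at h
    rw [zmod_two_ne_iff, ← edgeInd_eq_one, Prod.mk_sub_mk, sub_zero, h]
    generalize p (x, y) = p1
    generalize edgeInd C.edgeSet (vEdge (x, y)) = i1
    revert p1 i1
    decide
  refine ⟨p, fun a b e hab ha hb ↦ ?_⟩
  obtain ⟨v, rfl | rfl⟩ := isGridEdge_of_mem_squareEdges ha
  · rw [← hH]
    rcases hEdge_mem_squareEdges.1 ha with rfl | rfl <;>
      rcases hEdge_mem_squareEdges.1 hb with rfl | rfl <;>
      first | exact absurd rfl hab | exact Iff.rfl | exact ne_comm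
  · rw [← hV]
    rcases vEdge_mem_squareEdges.1 ha with rfl | rfl <;>
      rcases vEdge_mem_squareEdges.1 hb with rfl | rfl <;>
      first | exact absurd rfl hab | exact Iff.rfl | exact ne_comm

/-- If a finite set of squares and its complement are both connected, then its boundary is a
cycle. -/
lemma isCycle_boundaryEdges {A : Set GridV} (hfin : A.Finite) {z r : GridV}
    (hA : ∀ a ∈ A, a ∈ squareClass (boundaryEdges A) z)
    (hAc : ∀ b ∉ A, b ∈ squareClass (boundaryEdges A) r) (hne : (boundaryEdges A).Nonempty) :
    IsCycle (boundaryEdges A) := by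
  obtain ⟨C, hC⟩ := exists_gridCycle_of_hasNoLeaf (fun e ↦ isGridEdge_of_mem_boundaryEdges)
    (finite_boundaryEdges hfin) hne (hasNoLeaf_boundaryEdges A)
  refine ⟨C, hC.antisymm ?_⟩
  obtain ⟨p, hp⟩ := C.exists_parity
  have hconst : ∀ a b, b ∈ squareClass (boundaryEdges A) a → p b = p a := by
    intro a b hab
    induction hab with
    | refl => rfl
    | @tail c d _ hcd ih =>
      obtain ⟨e, he, hc, hd⟩ := hcd
      rw [← ih]
      by_contra hne
      exact he (hC ((hp c d e (fun h ↦ hne (h ▸ rfl)) hc hd).1 (Ne.symm hne)))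
  have hne_of : ∀ a ∈ A, ∀ b ∉ A, a ≠ b := fun a ha b hb h ↦ hb (h ▸ ha)
  obtain ⟨e₀, he₀⟩ := C.nonempty_edgeSet
  obtain ⟨a₀, ha₀, b₀, hb₀, h₁, h₂⟩ := hC he₀
  have hzr := (hp a₀ b₀ e₀ (hne_of _ ha₀ _ hb₀) h₁ h₂).2 he₀
  rw [hconst z a₀ (hA _ ha₀), hconst r b₀ (hAc _ hb₀)] at hzr
  rintro e ⟨a, ha, b, hb, hea, heb⟩
  refine (hp a b e (hne_of _ ha _ hb) hea heb).1 ?_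
  rwa [hconst z a (hA _ ha), hconst r b (hAc _ hb)]

end Cycles

section Component

variable {S : Set GridV}

lemma adjAvoiding_of_notMem {a b : GridV} {e : Sym2 GridV} (hab : a ≠ b) (ha : a ∉ S) (hb : b ∉ S)
    (hea : e ∈ squareEdges a) (heb : e ∈ squareEdges b) :
    AdjAvoiding (⋃ z ∈ S, squareEdges z) a b := by
  refine ⟨e, fun h ↦ ?_, hea, heb⟩
  simp only [Set.mem_iUnion, exists_prop] at h
  obtain ⟨z, hz, hez⟩ := h
  rcases eq_or_eq_of_mem_squareEdges hab hea heb hez with rfl | rfl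
  exacts [ha hz, hb hz]

lemma mem_squareClass_of_column {x : ℤ} (hx : ∀ y, (x, y) ∉ S) (y y' : ℤ) :
    (x, y') ∈ squareClass (⋃ z ∈ S, squareEdges z) (x, y) := by
  have key : ∀ (y : ℤ) (k : ℕ), (x, y + k) ∈ squareClass (⋃ z ∈ S, squareEdges z) (x, y) := by
    intro y k
    induction k with
    | zero => simpa using self_mem_squareClass _
    | succ k ih =>
      refine Relation.ReflTransGen.tail ih ?_
      refine adjAvoiding_of_notMem (e := hEdge (x, y + (k + 1 : ℕ))) (by simp) (hx _) (hx _) ?_ ?_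
      · refine hEdge_mem_squareEdges.2 (.inr ?_)
        simp only [Nat.cast_add, Nat.cast_one, Prod.mk_sub_mk, sub_zero, ← add_assoc,
          add_sub_cancel_right]
      · exact hEdge_mem_squareEdges.2 (.inl rfl)
  rcases le_total y y' with h | h
  · simpa [Int.toNat_of_nonneg (sub_nonneg.2 h)] using key y (y' - y).toNat
  · exact squareClass_symm
      (by simpa [Int.toNat_of_nonneg (sub_nonneg.2 h)] using key y' (y - y').toNat)

lemma mem_squareClass_of_row {y : ℤ} (hy : ∀ x, (x, y) ∉ S) (x x' : ℤ) :
    (x', y) ∈ squareClass (⋃ z ∈ S, squareEdges z) (x, y) := by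
  have key : ∀ (x : ℤ) (k : ℕ), (x + k, y) ∈ squareClass (⋃ z ∈ S, squareEdges z) (x, y) := by
    intro x k
    induction k with
    | zero => simpa using self_mem_squareClass _
    | succ k ih =>
      refine Relation.ReflTransGen.tail ih ?_
      refine adjAvoiding_of_notMem (e := vEdge (x + (k + 1 : ℕ), y)) (by simp) (hy _) (hy _) ?_ ?_
      · refine vEdge_mem_squareEdges.2 (.inr ?_)
        simp only [Nat.cast_add, Nat.cast_one, Prod.mk_sub_mk, sub_zero, ← add_assoc,
          add_sub_cancel_right]
      · exact vEdge_mem_squareEdges.2 (.inl rfl)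
  rcases le_total x x' with h | h
  · simpa [Int.toNat_of_nonneg (sub_nonneg.2 h)] using key x (x' - x).toNat
  · exact squareClass_symm
      (by simpa [Int.toNat_of_nonneg (sub_nonneg.2 h)] using key x' (x - x').toNat)

lemma mem_squareClass_empty (a b : GridV) : b ∈ squareClass ∅ a := by
  have h1 := mem_squareClass_of_row (S := ∅) (y := a.2) (fun _ h ↦ h) a.1 b.1
  have h2 := mem_squareClass_of_column (S := ∅) (x := b.1) (fun _ h ↦ h) a.2 b.2
  simp only [Set.mem_empty_iff_false, Set.iUnion_of_empty, Set.iUnion_empty] at h1 h2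
  exact squareClass_subset_of_mem h1 h2

lemma nonempty_boundaryEdges {A : Set GridV} {a b : GridV} (ha : a ∈ A) (hb : b ∉ A) :
    (boundaryEdges A).Nonempty := by
  obtain ⟨c, hc, d, hd, -, e, -, h1, h2⟩ := exists_crossing (mem_squareClass_empty a b) ha hb
  exact ⟨e, c, hc, d, hd, h1, h2⟩

/-- All but finitely many squares are connected to each other without crossing an edge of the
finite set `S` of squares. -/
lemma exists_finite_compl_squareClass (hS : S.Finite) :
    ∃ r ∉ S, (squareClass (⋃ z ∈ S, squareEdges z) r)ᶜ.Finite := by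
  obtain ⟨u, hu⟩ := hS.bddAbove
  obtain ⟨l, hl⟩ := hS.bddBelow
  have hout : ∀ x y, x > u.1 ∨ x < l.1 ∨ y > u.2 ∨ y < l.2 → (x, y) ∉ S := by
    intro x y h hxy
    have h1 := hu hxy
    have h2 := hl hxy
    simp only [Prod.le_def] at h1 h2
    omega
  refine ⟨(u.1 + 1, u.2 + 1), hout _ _ (by omega), (Set.finite_Icc l u).subset ?_⟩
  rintro ⟨x, y⟩ hxy
  by_contra hbox
  have hbox : (x > u.1 ∨ x < l.1) ∨ (y > u.2 ∨ y < l.2) := by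
    simp only [Set.mem_Icc, Prod.le_def] at hbox
    omega
  apply hxy
  rcases hbox with h | h
  · exact squareClass_subset_of_mem
      (mem_squareClass_of_row (fun x ↦ hout x _ (by omega)) _ x)
      (mem_squareClass_of_column (fun y ↦ hout _ y (by omega)) _ _)
  · exact squareClass_subset_of_mem
      (mem_squareClass_of_column (fun y ↦ hout _ y (by omega)) _ y)
      (mem_squareClass_of_row (fun x ↦ hout x _ (by omega)) _ _)

lemma squareClass_of_mem {z b : GridV} (hz : z ∈ S)
    (hb : b ∈ squareClass (⋃ z ∈ S, squareEdges z) z) : b = z := by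
  induction hb with
  | refl => rfl
  | tail _ hcd ih =>
    obtain ⟨e, he, hc, -⟩ := hcd
    subst ih
    exact absurd (Set.mem_biUnion hz hc) he

/-- The filled-in edge-connected component of a square `z` of a finite set `S` of squares. -/
lemma exists_filled_component (hS : S.Finite) {z : GridV} (hz : z ∈ S) :
    ∃ A : Set GridV, z ∈ A ∧ A.Finite ∧
      (∃ r ∉ A, ∀ b ∉ A, b ∈ squareClass (boundaryEdges A) r) ∧
      (∀ a ∈ A, a ∈ squareClass (boundaryEdges A) z) ∧
      (∀ a ∈ A, ∀ b ∉ A, ∀ e, e ∈ squareEdges a → e ∈ squareEdges b → a ∈ S ∧ b ∉ S) ∧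
      ∀ E ⊆ ⋃ z ∈ S, squareEdges z, (squareClass E z).Finite → squareClass E z ⊆ A := by
  obtain ⟨r, hrS, hr⟩ := exists_finite_compl_squareClass hS
  set G := ⋃ z ∈ S, squareEdges z with hG
  set U := squareClass G r with hU
  have hUinf : U.Infinite := fun h ↦ Set.infinite_univ (α := GridV)
    (by rw [← Set.union_compl_self U]; exact h.union hr)
  have hSU : ∀ s ∈ S, s ∉ U := fun s hs h ↦
    hrS ((squareClass_of_mem hs (squareClass_symm h)) ▸ hs)
  let A : Set GridV := {w | Relation.ReflTransGen
    (fun a b ↦ b ∉ U ∧ ∃ e, e ∈ squareEdges a ∧ e ∈ squareEdges b) z w}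
  have hzA : z ∈ A := Relation.ReflTransGen.refl
  have hAU : ∀ a ∈ A, a ∉ U := by
    intro a ha
    induction ha with
    | refl => exact hSU z hz
    | tail _ h _ => exact h.1
  have hstep : ∀ a ∈ A, ∀ b ∉ A, ∀ e, e ∈ squareEdges a → e ∈ squareEdges b → b ∈ U := by
    intro a ha b hb e hea heb
    by_contra hbU
    exact hb (Relation.ReflTransGen.tail ha ⟨hbU, e, hea, heb⟩)
  have hbdS : ∀ a ∈ A, ∀ b ∉ A, ∀ e, e ∈ squareEdges a → e ∈ squareEdges b → a ∈ S ∧ b ∉ S := by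
    intro a ha b hb e hea heb
    have hbU := hstep a ha b hb e hea heb
    have hbS : b ∉ S := fun h ↦ hSU b h hbU
    refine ⟨?_, hbS⟩
    by_contra haS
    refine hAU a ha (Relation.ReflTransGen.tail hbU ?_)
    exact adjAvoiding_of_notMem (fun h ↦ hb (h ▸ ha)) hbS haS heb hea
  have hrA : r ∉ A := fun h ↦ hAU r h (self_mem_squareClass r)
  have hbdG : boundaryEdges A ⊆ G := by
    rintro e ⟨a, ha, b, hb, hea, heb⟩
    exact Set.mem_biUnion (hbdS a ha b hb e hea heb).1 hea
  refine ⟨A, hzA, hr.subset hAU, ⟨r, hrA, ?_⟩, ?_, hbdS, ?_⟩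
  · have hUA : ∀ b ∈ U, b ∈ squareClass (boundaryEdges A) r := fun b hb ↦
      squareClass_anti hbdG r hb
    intro b hb
    by_contra hbr
    have hrb : r ∉ squareClass (boundaryEdges A) b := fun h ↦ hbr (squareClass_symm h)
    have hbA : ∀ c ∈ squareClass (boundaryEdges A) b, c ∉ A := by
      intro c hc
      induction hc with
      | refl => exact hb
      | @tail c d _ hcd ih =>
        obtain ⟨e, he, hec, hed⟩ := hcd
        exact fun hd ↦ he ⟨d, hd, c, ih, hed, hec⟩
    obtain ⟨e, he⟩ := nonempty_boundaryEdges (self_mem_squareClass b) hrb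
    obtain ⟨a, ha, b', hb', hea, heb'⟩ := boundaryEdges_squareClass_subset he
    obtain ⟨k, hk, k', hk', hek, hek'⟩ := he
    have hab' : a ≠ b' := fun h ↦ hb' (h ▸ ha)
    rcases eq_or_eq_of_mem_squareEdges hab' hea heb' hek with rfl | rfl
    · exact hbA _ hk ha
    · exact hrb (squareClass_subset_of_mem hk
        (squareClass_symm (hUA _ (hstep a ha _ hb' e hea heb'))))
  · intro a ha
    induction ha with
    | refl => exact self_mem_squareClass _
    | @tail c d hc hcd ih =>
      obtain ⟨hdU, e, hec, hed⟩ := hcd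
      have hd : d ∈ A := Relation.ReflTransGen.tail hc ⟨hdU, e, hec, hed⟩
      by_cases hcd : c = d
      · exact hcd ▸ ih
      refine Relation.ReflTransGen.tail ih ⟨e, ?_, hec, hed⟩
      rintro ⟨a, -, b, hb, -, heb⟩
      rcases eq_or_eq_of_mem_squareEdges hcd hec hed heb with rfl | rfl
      exacts [hb hc, hb hd]
  · intro E hE hfin b hb
    have hcl : ∀ w ∈ squareClass E z, w ∉ U := by
      intro w hw hwU
      refine hUinf (hfin.subset ?_)
      rw [hU, ← squareClass_eq_of_mem hwU, ← squareClass_eq_of_mem hw]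
      exact squareClass_anti hE w
    induction hb with
    | refl => exact hzA
    | @tail c d hc hcd ih =>
      obtain ⟨e, he, hec, hed⟩ := hcd
      exact Relation.ReflTransGen.tail ih
        ⟨hcl d (Relation.ReflTransGen.tail hc ⟨e, he, hec, hed⟩), e, hec, hed⟩

end Component

section Uniqueness

lemma starAdj_of_mem_squareEdges {a b : GridV} {e : Sym2 GridV} (hab : a ≠ b)
    (ha : e ∈ squareEdges a) (hb : e ∈ squareEdges b) : starAdj a b := by
  refine ⟨hab, ?_⟩
  obtain ⟨v, rfl | rfl⟩ := isGridEdge_of_mem_squareEdges ha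
  · rcases hEdge_mem_squareEdges.1 ha with rfl | rfl <;>
      rcases hEdge_mem_squareEdges.1 hb with rfl | rfl <;> simp
  · rcases vEdge_mem_squareEdges.1 ha with rfl | rfl <;>
      rcases vEdge_mem_squareEdges.1 hb with rfl | rfl <;> simp

variable {ω : GridV → Prop} {z : GridV} {D D' : Set (Sym2 GridV)}

/-- Squares outside an outermost cycle are outside every other outermost cycle. -/
lemma isOutermostCycleOf.infinite_squareClass (hD : isOutermostCycleOf ω z D)
    (hD' : isOutermostCycleOf ω z D') {a : GridV} (ha : (squareClass D' a).Infinite) :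
    (squareClass D a).Infinite := by
  intro hfin
  obtain ⟨b, hb, hb'⟩ := ha.exists_notMem_finite hfin
  obtain ⟨c, hc, d, hd, hca, e, he, hec, hed⟩ := exists_crossing hb (self_mem_squareClass a) hb'
  have heD : e ∈ D := by
    by_contra h
    exact hd (Relation.ReflTransGen.tail hc ⟨e, h, hec, hed⟩)
  have hint := (hD'.2.2.2 D hD.1 hD.2.1 e heD).resolve_left he
  rw [← squareClass_eq_of_mem hca] at ha
  exact he (mem_of_edgeSeg_inInterior_of_infinite
    (fun f hf ↦ isGridEdge_of_isCycle hD'.1.1 hf) ha hec hint)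

lemma isOutermostCycleOf.subset (hD : isOutermostCycleOf ω z D)
    (hD' : isOutermostCycleOf ω z D') : D ⊆ D' := by
  intro e he
  have hgrid : ∀ f ∈ D, IsGridEdge f := fun f hf ↦ isGridEdge_of_isCycle hD.1.1 hf
  obtain ⟨⟨a, -, hea, ha⟩, b, -, heb, hb⟩ := hD.2.2.1 e he
  rw [inInterior_squareSet_iff hgrid] at ha
  rw [inExterior_squareSet_iff hgrid] at hb
  have hb' := hD'.infinite_squareClass hD hb
  by_contra he'
  have hab : a ∈ squareClass D' b := .single ⟨e, he', heb, hea⟩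
  rw [← squareClass_eq_of_mem hab] at hb'
  exact hD.infinite_squareClass hD' hb' ha

end Uniqueness

/-- If `C(0)` is finite and nonempty, then every square `S_k ∈ C(0)`
has a unique outermost boundary cycle `D_k` in `G_C`: (a) `S_k` lies in the interior of
`D_k`; (b) every edge of `D_k` is a boundary edge adjacent to an occupied square of
`C(0)` in the interior of `D_k` and to a vacant square in the exterior of `D_k`;
(c) every cycle of `G_C` containing `S_k` in its interior has all its edges on `D_k` or
in the interior of `D_k`. -/
theorem exists_unique_outermost_cycle (ω : GridV → Prop)
    (hfin : (starComp ω).Finite) (hne : (starComp ω).Nonempty) :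
    ∀ z ∈ starComp ω, ∃! D : Set (Sym2 GridV), isOutermostCycleOf ω z D := by
  intro z hz
  obtain ⟨A, hzA, hAfin, ⟨r, hrA, hr⟩, hA, hbd, hmax⟩ := exists_filled_component hfin hz
  have hgrid : ∀ e ∈ boundaryEdges A, IsGridEdge e := fun e ↦ isGridEdge_of_mem_boundaryEdges
  have hbdG : boundaryEdges A ⊆ gcEdges ω := by
    rintro e ⟨a, ha, b, hb, hea, heb⟩
    exact Set.mem_biUnion (hbd a ha b hb e hea heb).1 hea
  have hin : ∀ a ∈ A, inInterior (boundaryEdges A) (squareSet a) := by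
    intro a ha
    refine inInterior_of_finite (hAfin.subset fun b hb ↦ ?_)
    by_contra hbA
    obtain ⟨c, hc, d, hd, -, e, he, hec, hed⟩ := exists_crossing hb ha hbA
    exact he ⟨c, hc, d, hd, hec, hed⟩
  have hout : ∀ b ∉ A, inExterior (boundaryEdges A) (squareSet b) := by
    intro b hb
    refine inExterior_of_infinite hgrid (hAfin.infinite_compl.mono fun c hc ↦ ?_)
    exact squareClass_subset_of_mem (squareClass_symm (hr b hb)) (hr c hc)
  have hB : isOutermostCycleOf ω z (boundaryEdges A) := by
    refine ⟨⟨?_, hbdG⟩, hin z hzA, ?_, ?_⟩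
    · exact isCycle_boundaryEdges hAfin hA hr (nonempty_boundaryEdges hzA hrA)
    · rintro e ⟨a, ha, b, hb, hea, heb⟩
      obtain ⟨haS, hbS⟩ := hbd a ha b hb e hea heb
      refine ⟨⟨a, haS, hea, hin a ha⟩, b, fun hωb ↦ hbS ⟨hωb, ?_⟩, heb, hout b hb⟩
      exact haS.2.tail ⟨haS.1, hωb, starAdj_of_mem_squareEdges (fun h ↦ hb (h ▸ ha)) hea heb⟩
    · rintro C ⟨hC, hCG⟩ hCz e he
      have hfinC := (inInterior_squareSet_iff fun f hf ↦ isGridEdge_of_isCycle hC hf).1 hCz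
      obtain ⟨b, hb⟩ := hfinC.exists_notMem
      obtain ⟨C, rfl⟩ := hC
      have hCeq := C.eq_edgeSet_of_hasNoLeaf boundaryEdges_squareClass_subset
        (nonempty_boundaryEdges (self_mem_squareClass z) hb) (hasNoLeaf_boundaryEdges _)
      rw [← hCeq] at he
      obtain ⟨a, ha, -, -, hea, -⟩ := he
      exact .inr ((edgeSeg_subset_squareSet hea).trans (hin a (hmax _ hCG hfinC ha)))
  exact ⟨_, hB, fun D hD ↦ hD.subset hB |>.antisymm (hB.subset hD)⟩
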